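/- arXiv:0906.2183 — 2 statements merged into one kernel-verified Lean document; each statement's English description precedes it below -/
import Mathlib

section
/- Let S = 1^{n_1}0^{m_1}⋯1^{n_r}0^{m_r} with all n_j, m_j ≥ 1 and n_1+⋯+n_r = m_1+⋯+m_r = n (so S is balanced of length 2n with r runs). Then φ(S) ≤ (r^{r−1}/r!)·(1+n)^{r−1} as real numbers. -/
/-- A pairing of the positions `Fin N`: a collection of blocks, each of size 2,
with every position in exactly one block. -/
def IsPairing {N : ℕ} (π : Finset (Finset (Fin N))) : Prop :=
  (∀ B ∈ π, B.card = 2) ∧ ∀ i : Fin N, ∃! B, B ∈ π ∧ i ∈ B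

/-- A crossing: blocks `{i₁,i₂}` and `{j₁,j₂}` with `i₁ < j₁ < i₂ < j₂`. -/
def HasCrossing {N : ℕ} (π : Finset (Finset (Fin N))) : Prop :=
  ∃ B ∈ π, ∃ C ∈ π, ∃ i₁ i₂ j₁ j₂ : Fin N,
    i₁ ∈ B ∧ i₂ ∈ B ∧ j₁ ∈ C ∧ j₂ ∈ C ∧ i₁ < j₁ ∧ j₁ < i₂ ∧ i₂ < j₂

/-- A non-crossing `w`-pairing: a non-crossing pairing of the positions of the
bitstring `w` (ones are `true`, zeros are `false`) pairing unequal letters. -/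
def IsNCPairingOn (w : List Bool) (π : Finset (Finset (Fin w.length))) : Prop :=
  IsPairing π ∧ ¬ HasCrossing π ∧
    ∀ B ∈ π, ∀ i ∈ B, ∀ j ∈ B, i ≠ j → w.get i ≠ w.get j

/-- `phi w` is the number of non-crossing `w`-pairings. -/
noncomputable def phi (w : List Bool) : ℕ :=
  Set.ncard {π : Finset (Finset (Fin w.length)) | IsNCPairingOn w π}

/-- The word `1^{n 0} 0^{m 0} 1^{n 1} 0^{m 1} ⋯ 1^{n (r-1)} 0^{m (r-1)}`. -/
def runsF {r : ℕ} (n m : Fin r → ℕ) : List Bool :=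
  (List.finRange r).flatMap fun i => List.replicate (n i) true ++ List.replicate (m i) false

/-- The word `1^{k₁} 0^{k₁} ⋯ 1^{k_r} 0^{k_r}` for `l = [k₁, …, k_r]`. -/
def symWord (l : List ℕ) : List Bool :=
  l.flatMap fun k => List.replicate k true ++ List.replicate k false

/-- The symmetrized pairing function `φ*(n₁,…,n_r) = φ(1^{n₁}0^{n₁}⋯1^{n_r}0^{n_r})`. -/
noncomputable def phiStar (l : List ℕ) : ℕ := phi (symWord l)

/-- `Yval w i` is the lattice-path value `Y_i`. -/
def Yval (w : List Bool) (i : ℕ) : ℤ :=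
  ((w.take i).count true : ℤ) - ((w.take i).count false : ℤ)

/-- The height of position `i` of `w`, relative to the minimum `mY` of the `Y_i`. -/
def heightAt (w : List Bool) (mY : ℤ) (i : Fin w.length) : ℤ :=
  if w.get i then Yval w (i.val + 1) - mY else Yval w (i.val + 1) - mY + 1

/-- `d : Fin r → ℕ` is a Catalan degree sequence of order `r`. -/
def IsCatalanSeq (r : ℕ) (d : Fin r → ℕ) : Prop :=
  (∀ i : ℕ, 1 ≤ i → i ≤ r - 1 →
      (i : ℕ) ≤ ∑ j ∈ Finset.univ.filter (fun j : Fin r => (j : ℕ) < i), d j) ∧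
  ∑ j, d j = r - 1

/-- Sum of the first `j` values of `f`. -/
def prefSum {r : ℕ} (f : Fin r → ℕ) (j : ℕ) : ℕ :=
  ∑ i ∈ Finset.univ.filter (fun i : Fin r => (i : ℕ) < j), f i

/-- `m` is a member of `CF(n)`. -/
def InCF {r : ℕ} (n m : Fin r → ℕ) : Prop :=
  (∀ j : ℕ, 1 ≤ j → j ≤ r - 1 → prefSum m j ≤ prefSum n j) ∧
  (∑ i, m i = ∑ i, n i)

/-- The number of ways to read the word in the second argument with a stack machine that starts
from the given stack and ends with the empty stack, where each letter is either pushed, or removes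
the letter on top of the stack, which has to be different from it. -/
def stackCount : List Bool → List Bool → ℕ
  | s, [] => if s = [] then 1 else 0
  | [], a :: w => stackCount [a] w
  | b :: s, a :: w => stackCount (a :: b :: s) w + if b ≠ a then stackCount s w else 0

/-- Fixed-point-free involutions of the positions of `w` that encode non-crossing `w`-pairings. -/
def IsNCInvolution (w : List Bool) (f : Fin w.length → Fin w.length) : Prop :=
  (∀ i, f (f i) = i) ∧ (∀ i, w.get (f i) ≠ w.get i) ∧
    ∀ i j, i < j → j < f i → f i < f j → False

/-- The non-crossing involutions that agree with `g` on the pairs inside the first `k` positions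
and for which `S` lists, in decreasing order, the positions before `k` that are still open. -/
def ncInvolutionsAt (w : List Bool) (k : ℕ) (S : List (Fin w.length))
    (g : Fin w.length → Fin w.length) : Set (Fin w.length → Fin w.length) :=
  {f | IsNCInvolution w f ∧ (∀ j, j.val < k → (f j).val < k → f j = g j) ∧
    S.Pairwise (· > ·) ∧ ∀ j, j ∈ S ↔ (j.val < k ∧ k ≤ (f j).val)}

theorem encard_ncInvolutionsAt_le (w : List Bool) (l : ℕ) :
    ∀ k S g, k + l = w.length →
      (ncInvolutionsAt w k S g).encard ≤ (stackCount (S.map w.get) (w.drop k) : ℕ∞) := by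
  induction l with
  | zero =>
    intro k S g hk
    have hk : k = w.length := by omega
    subst hk
    cases S with
    | nil =>
      simp only [List.map_nil, List.drop_length, stackCount, if_true, Nat.cast_one]
      rw [Set.encard_le_one_iff]
      intro f₁ f₂ h₁ h₂
      funext j
      rw [h₁.2.1 j j.2 (f₁ j).2, h₂.2.1 j j.2 (f₂ j).2]
    | cons h T =>
      have : ncInvolutionsAt w w.length (h :: T) g = ∅ := by
        ext f
        simp only [Set.mem_empty_iff_false, iff_false]
        intro hf
        have := ((hf.2.2.2 h).1 (by simp)).2
        have := (f h).2
        omega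
      rw [this]
      simp
  | succ l ih =>
    intro k S g hk
    have hkl : k < w.length := by omega
    set i : Fin w.length := ⟨k, hkl⟩ with hi
    have hdrop : w.drop k = w.get i :: w.drop (k + 1) := by
      simp [hi]
    have hpush : ∀ f ∈ ncInvolutionsAt w k S g, i < f i →
        f ∈ ncInvolutionsAt w (k + 1) (i :: S) g := by
      rintro f ⟨hf, hg, hS, hm⟩ hlt
      have hlt' : k < (f i).val := hlt
      refine ⟨hf, ?_, ?_, ?_⟩
      · intro j hj hfj
        have h1 : j ≠ i := by rintro rfl; omega
        have h1' : j.val ≠ k := fun h => h1 (Fin.ext h)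
        have h2 : (f j).val ≠ k := by
          intro h
          have : f j = i := Fin.ext h
          have h3 := hf.1 j
          rw [this] at h3
          rw [h3] at hlt'
          omega
        exact hg j (by omega) (by omega)
      · rw [List.pairwise_cons]
        exact ⟨fun j hj => ((hm j).1 hj).1, hS⟩
      · intro j
        rw [List.mem_cons, hm j]
        constructor
        · rintro (rfl | ⟨h1, h2⟩)
          · exact ⟨by simp [hi], hlt'⟩
          · refine ⟨by omega, ?_⟩
            have h2 : (f j).val ≠ k := by
              intro h
              have : f j = i := Fin.ext h
              have h3 := hf.1 j
              rw [this] at h3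
              rw [h3] at hlt'
              omega
            omega
        · rintro ⟨h1, h2⟩
          by_cases h : j.val = k
          · exact Or.inl (Fin.ext h)
          · exact Or.inr ⟨by omega, by omega⟩
    have hpop : ∀ f ∈ ncInvolutionsAt w k S g, f i < i →
        ∃ T, S = f i :: T ∧ f ∈ ncInvolutionsAt w (k + 1) T
          (Function.update (Function.update g i (f i)) (f i) i) := by
      rintro f ⟨hf, hg, hS, hm⟩ hlt
      have hlt' : (f i).val < k := hlt
      have hmem : f i ∈ S := (hm _).2 ⟨hlt', by rw [hf.1]⟩
      cases S with
      | nil => simp at hmem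
      | cons h T =>
        rw [List.pairwise_cons] at hS
        have hh := (hm h).1 (by simp)
        have heq : h = f i := by
          by_contra hne
          have h1 : f i ∈ T := by
            rcases List.mem_cons.1 hmem with h2 | h2
            · exact absurd h2.symm hne
            · exact h2
          have h2 : f i < h := hS.1 _ h1
          have h3 : (f h).val ≠ k := by
            intro h3
            have h4 : f h = i := Fin.ext h3
            exact hne (by rw [← h4, hf.1])
          refine hf.2.2 (f i) h h2 ?_ ?_
          · rw [hf.1]; exact hh.1
          · rw [hf.1]
            have : k < (f h).val := by omega
            exact this
        subst heq
        refine ⟨T, rfl, hf, ?_, hS.2, ?_⟩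
        · intro j hj hfj
          by_cases h1 : j = f i
          · subst h1
            rw [hf.1, Function.update_self]
          rw [Function.update_of_ne h1]
          by_cases h2 : j = i
          · subst h2
            rw [Function.update_self]
          rw [Function.update_of_ne h2]
          have h2' : j.val ≠ k := fun h => h2 (Fin.ext h)
          have h3 : (f j).val ≠ k := by
            intro h
            have : f j = i := Fin.ext h
            exact h1 (by rw [← this, hf.1])
          exact hg j (by omega) (by omega)
        · intro j
          constructor
          · intro hj
            have h1 := (hm j).1 (List.mem_cons_of_mem _ hj)
            have h2 : (f j).val ≠ k := by
              intro h
              have h3 : f j = i := Fin.ext h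
              have h4 : j = f i := by rw [← h3, hf.1]
              have := hS.1 j hj
              rw [h4] at this
              exact lt_irrefl _ this
            exact ⟨by omega, by omega⟩
          · rintro ⟨h1, h2⟩
            have h3 : j.val ≠ k := by
              intro h
              have h3 : j = i := Fin.ext h
              rw [h3] at h2
              omega
            have h4 := (hm j).2 ⟨by omega, by omega⟩
            rcases List.mem_cons.1 h4 with h5 | h5
            · rw [h5, hf.1] at h2
              simp [hi] at h2
            · exact h5
    have hne : ∀ f ∈ ncInvolutionsAt w k S g, ¬ i < f i → f i < i := by
      intro f hf h
      refine lt_of_le_of_ne (not_lt.1 h) fun h' => hf.1.2.1 i (by rw [h'])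
    rw [hdrop]
    cases S with
    | nil =>
      simp only [List.map_nil, stackCount]
      refine le_trans (Set.encard_le_encard ?_) (ih (k + 1) [i] g (by omega))
      intro f hf
      by_cases h : i < f i
      · exact hpush f hf h
      · obtain ⟨T, hT, -⟩ := hpop f hf (hne f hf h)
        simp at hT
    | cons h T =>
      simp only [List.map_cons, stackCount]
      have hpush_le := ih (k + 1) (i :: h :: T) g (by omega)
      split_ifs with hw
      · have hpop_le := ih (k + 1) T (Function.update (Function.update g i h) h i) (by omega)
        push_cast
        refine le_trans (Set.encard_le_encard ?_)
          (le_trans (Set.encard_union_le _ _) (add_le_add hpush_le hpop_le))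
        intro f hf
        by_cases h : i < f i
        · exact Or.inl (hpush f hf h)
        · obtain ⟨T, hT, hfT⟩ := hpop f hf (hne f hf h)
          rw [List.cons.injEq] at hT
          obtain ⟨rfl, rfl⟩ := hT
          exact Or.inr hfT
      · rw [add_zero]
        refine le_trans (Set.encard_le_encard ?_) hpush_le
        intro f hf
        by_cases h : i < f i
        · exact hpush f hf h
        · obtain ⟨T, hT, hfT⟩ := hpop f hf (hne f hf h)
          rw [List.cons.injEq] at hT
          obtain ⟨rfl, rfl⟩ := hT
          exact absurd (hf.1.2.1 i) (by simpa using hw)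

theorem IsNCPairingOn.exists_involution {w : List Bool} {π : Finset (Finset (Fin w.length))}
    (hπ : IsNCPairingOn w π) :
    ∃ f, IsNCInvolution w f ∧ π = Finset.univ.image fun i => {i, f i} := by
  obtain ⟨⟨hcard, huniq⟩, hcross, hlet⟩ := hπ
  have hex : ∀ i, ∃ j, j ≠ i ∧ {i, j} ∈ π := by
    intro i
    obtain ⟨B, ⟨hB, hiB⟩, -⟩ := huniq i
    obtain ⟨x, y, hxy, rfl⟩ := Finset.card_eq_two.1 (hcard B hB)
    rcases Finset.mem_insert.1 hiB with rfl | h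
    · exact ⟨y, hxy.symm, hB⟩
    · rw [Finset.mem_singleton] at h
      subst h
      exact ⟨x, hxy, by rwa [Finset.pair_comm]⟩
  choose f hf hfπ using hex
  have hblock : ∀ B ∈ π, ∀ i ∈ B, B = {i, f i} := fun B hB i hi =>
    (huniq i).unique ⟨hB, hi⟩ ⟨hfπ i, by simp⟩
  have hinv : ∀ i, f (f i) = i := by
    intro i
    have h := hblock _ (hfπ i) (f i) (by simp)
    have h1 : f (f i) ∈ ({i, f i} : Finset (Fin w.length)) := by rw [h]; simp
    rcases Finset.mem_insert.1 h1 with h2 | h2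
    · exact h2
    · exact absurd (Finset.mem_singleton.1 h2) (hf (f i))
  refine ⟨f, ⟨hinv, fun i => hlet _ (hfπ i) _ (by simp) _ (by simp) (hf i), ?_⟩, ?_⟩
  · intro i j h1 h2 h3
    exact hcross ⟨_, hfπ i, _, hfπ j, i, f i, j, f j, by simp, by simp, by simp, by simp,
      h1, h2, h3⟩
  · ext B
    simp only [Finset.mem_image, Finset.mem_univ, true_and]
    constructor
    · intro hB
      obtain ⟨x, y, hxy, h⟩ := Finset.card_eq_two.1 (hcard B hB)
      exact ⟨x, (hblock B hB x (by simp [h])).symm⟩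
    · rintro ⟨i, rfl⟩
      exact hfπ i

theorem phi_le_stackCount (w : List Bool) : phi w ≤ stackCount [] w := by
  have h0 : {f | IsNCInvolution w f}.encard ≤ (stackCount [] w : ℕ∞) := by
    refine le_trans (Set.encard_le_encard ?_) (encard_ncInvolutionsAt_le w w.length 0 [] id (by simp))
    intro f hf
    exact ⟨hf, by simp, by simp, by simp⟩
  have h1 : {π | IsNCPairingOn w π} ⊆
      (fun f => Finset.univ.image fun i => {i, f i}) '' {f | IsNCInvolution w f} := by
    intro π hπ
    obtain ⟨f, hf, rfl⟩ := IsNCPairingOn.exists_involution hπ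
    exact ⟨f, hf, rfl⟩
  have h2 := (Set.encard_le_encard h1).trans ((Set.encard_image_le _ _).trans h0)
  unfold phi
  rw [Set.ncard_def]
  exact ENat.toNat_le_of_le_natCast h2

theorem stackCount_append_singleton (a : Bool) (w : List Bool) :
    (stackCount [a] w = stackCount [] (w ++ [a])) ∧
    (∀ s, stackCount (s ++ [a, a]) w = stackCount (s ++ [a]) (w ++ [a])) ∧
    ∀ s, stackCount (s ++ [!a, a]) w + stackCount s w = stackCount (s ++ [!a]) (w ++ [a]) := by
  induction w with
  | nil =>
    refine ⟨by simp [stackCount], fun s => ?_, fun s => ?_⟩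
    · rcases s with _ | ⟨x, _ | ⟨y, s⟩⟩ <;> simp [stackCount]
    · rcases s with _ | ⟨x, _ | ⟨y, s⟩⟩ <;> simp [stackCount]
  | cons b w ih =>
    obtain ⟨h1, h2, h3⟩ := ih
    have h20 := h2 []
    have h30 := h3 []
    simp only [List.nil_append] at h20 h30
    refine ⟨?_, fun s => ?_, fun s => ?_⟩
    · cases a <;> cases b <;> simp_all [stackCount]
    · rcases s with _ | ⟨x, s⟩
      · have := h2 [b]
        simp only [List.cons_append, List.nil_append] at this
        simp only [List.cons_append, List.nil_append, stackCount, this, h1]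
      · have e1 := h2 (b :: x :: s)
        have e2 := h2 s
        simp only [List.cons_append] at e1
        simp only [List.cons_append, stackCount, e1, e2]
    · rcases s with _ | ⟨x, s⟩
      · have := h3 [b]
        simp only [List.cons_append, List.nil_append] at this
        simp only [List.cons_append, List.nil_append, stackCount, ← this, h1]
        ring
      · have e1 := h3 (b :: x :: s)
        have e2 := h3 s
        simp only [List.cons_append] at e1
        simp only [List.cons_append, stackCount, ← e1, ← e2]
        split_ifs <;> ring

theorem stackCount_append_singleton_le (a : Bool) (s w : List Bool) :
    stackCount (s ++ [a]) w ≤ stackCount s (w ++ [a]) := by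
  obtain ⟨h1, h2, h3⟩ := stackCount_append_singleton a w
  rcases List.eq_nil_or_concat s with rfl | ⟨s, b, rfl⟩
  · exact h1.le
  · have h2 := h2 s
    have h3 := h3 s
    have hb : b = a ∨ b = !a := by cases a <;> cases b <;> simp
    rcases hb with rfl | rfl <;>
      simp only [List.concat_eq_append, List.append_assoc, List.cons_append, List.nil_append] <;>
      omega

theorem stackCount_replicate_le (a : Bool) (d : ℕ) (w : List Bool) :
    stackCount (List.replicate d a) w ≤ stackCount [] (w ++ List.replicate d a) := by
  induction d generalizing w with
  | zero => simp
  | succ d ih =>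
    have h := (stackCount_append_singleton_le a (List.replicate d a) w).trans (ih (w ++ [a]))
    rw [← List.replicate_succ'] at h
    simpa [List.replicate_succ] using h

theorem stackCount_nil_append_comm (u v : List Bool) :
    stackCount [] (u ++ v) = stackCount [] (v ++ u) := by
  induction u generalizing v with
  | nil => simp
  | cons a u ih =>
    rw [List.cons_append, stackCount, (stackCount_append_singleton a _).1, List.append_assoc, ih]
    simp

theorem stackCount_replicate_append_same (a : Bool) (j k : ℕ) (s w : List Bool) :
    stackCount (List.replicate (j + 1) a ++ s) (List.replicate k a ++ w) =
      stackCount (List.replicate (j + 1 + k) a ++ s) w := by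
  induction k generalizing j with
  | zero => simp
  | succ k ih =>
    have h := ih (j + 1)
    rw [show j + 1 + 1 + k = j + 1 + (k + 1) by omega] at h
    rw [← h]
    simp [List.replicate_succ, stackCount]

theorem stackCount_nil_replicate_append (a : Bool) (k : ℕ) (w : List Bool) :
    stackCount [] (List.replicate k a ++ w) = stackCount (List.replicate k a) w := by
  cases k with
  | zero => simp
  | succ k =>
    have h := stackCount_replicate_append_same a 0 k [] w
    simp only [List.append_nil, zero_add] at h
    rw [List.replicate_succ, List.cons_append, stackCount, ← List.replicate_one, h, add_comm 1 k,
      List.replicate_succ]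

theorem stackCount_replicate_replicate_append (k : ℕ) (w : List Bool) :
    stackCount (List.replicate k false) (List.replicate k true ++ w) =
      ∑ d ∈ Finset.range (k + 1),
        stackCount (List.replicate d true ++ List.replicate d false) w := by
  induction k with
  | zero => simp
  | succ k ih =>
    rw [Finset.sum_range_succ, ← ih, List.replicate_succ, List.replicate_succ, List.cons_append,
      stackCount]
    have h := stackCount_replicate_append_same true 0 k (List.replicate (k + 1) false) w
    simp only [zero_add, List.replicate_one, List.cons_append, List.nil_append] at h
    rw [← List.replicate_succ (n := k) (a := false), h, add_comm 1 k, ← List.replicate_succ]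
    simp [add_comm]

/-- Split at the moment when the letter `true` at the bottom of `s ++ [true]` is removed. -/
theorem stackCount_append_le (s t w : List Bool) :
    stackCount (s ++ true :: t) w ≤ ∑ i ∈ Finset.range w.length,
      if w[i]? = some false then
        stackCount (s ++ [true]) (w.take (i + 1)) * stackCount t (w.drop (i + 1)) else 0 := by
  induction w generalizing s with
  | nil => cases s <;> simp [stackCount]
  | cons b w ih =>
    rw [List.length_cons, Finset.sum_range_succ']
    simp only [List.getElem?_cons_succ, List.take_succ_cons, List.drop_succ_cons,
      List.getElem?_cons_zero, Option.some.injEq, List.take_zero, List.drop_zero, zero_add]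
    rcases s with _ | ⟨x, s⟩
    · simp only [List.nil_append, stackCount]
      refine add_le_add (le_trans (ih [b]) (Finset.sum_le_sum fun i _ => ?_)) ?_
      · by_cases h : w[i]? = some false
        · simp only [h, if_true, List.cons_append, List.nil_append]
          exact Nat.mul_le_mul_right _ (Nat.le_add_right _ _)
        · simp [h]
      · cases b <;> simp
    · simp only [List.cons_append, stackCount]
      refine le_trans (add_le_add (ih (b :: x :: s)) (?_ : _ ≤ ∑ i ∈ Finset.range w.length,
        if w[i]? = some false then (if x ≠ b then
          stackCount (s ++ [true]) (w.take (i + 1)) else 0) * stackCount t (w.drop (i + 1))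
          else 0)) ?_
      · split_ifs
        · exact ih s
        · exact Nat.zero_le _
      · rw [← Finset.sum_add_distrib]
        refine le_trans (Finset.sum_le_sum fun i _ => ?_) (Nat.le_add_right _ _)
        by_cases h : w[i]? = some false
        · simp only [h, if_true, List.cons_append, add_mul, le_refl]
        · simp [h]

theorem stackCount_replicate_right (a : Bool) (d : ℕ) (s : List Bool) :
    stackCount s (List.replicate d a) = if s = List.replicate d (!a) then 1 else 0 := by
  induction d generalizing s with
  | zero => simp [stackCount]
  | succ d ih =>
    have h : ∀ t : List Bool, a :: t ≠ List.replicate d (!a) := by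
      intro t ht
      have := List.eq_of_mem_replicate (ht ▸ List.mem_cons_self : a ∈ List.replicate d (!a))
      simp at this
    rcases s with _ | ⟨b, s⟩
    · simp [List.replicate_succ, stackCount, ih, h]
    · simp only [List.replicate_succ, stackCount, ih, h, if_false, zero_add, List.cons.injEq]
      cases a <;> cases b <;> simp

/-- Different values of `d` account for different stacks between `u` and `v`. -/
theorem sum_stackCount_mul_le (D : Finset ℕ) (s u v : List Bool) :
    ∑ d ∈ D, stackCount s (u ++ List.replicate d true) *
      stackCount (List.replicate d false) v ≤ stackCount s (u ++ v) := by
  induction u generalizing s with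
  | nil =>
    calc _ ≤ ∑ d ∈ D, if s.length = d then stackCount s v else 0 := by
          refine Finset.sum_le_sum fun d _ => ?_
          rw [List.nil_append, stackCount_replicate_right]
          split_ifs with h1 h2 h2
          · simp [h1]
          · simp [h1] at h2
          · simp
          · simp
      _ ≤ _ := by
          rw [Finset.sum_ite_eq]
          split_ifs <;> simp
  | cons a u ih =>
    rcases s with _ | ⟨b, s⟩
    · simpa only [List.cons_append, stackCount] using ih [a]
    · simp only [List.cons_append, stackCount, add_mul, Finset.sum_add_distrib]
      refine add_le_add (ih _) ?_
      split_ifs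
      · exact ih s
      · simp

theorem sum_range_ite_getElem? (w : List Bool) (a : Bool) (c : ℕ) :
    (∑ i ∈ Finset.range w.length, if w[i]? = some a then c else 0) = w.count a * c := by
  induction w with
  | nil => simp
  | cons b w ih =>
    rw [List.length_cons, Finset.sum_range_succ']
    simp only [List.getElem?_cons_succ, ih, List.getElem?_cons_zero, Option.some.injEq,
      List.count_cons, beq_iff_eq]
    split_ifs <;> ring

theorem stackCount_valley_append_le (k : ℕ) (w : List Bool) :
    stackCount [] (List.replicate k false ++ List.replicate k true ++ w) ≤
      (w.count false + 1) * stackCount [] w := by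
  rw [List.append_assoc, stackCount_nil_replicate_append, stackCount_replicate_replicate_append,
    Finset.sum_range_succ', add_mul, one_mul]
  refine add_le_add ?_ (by simp)
  calc _ ≤ ∑ d ∈ Finset.range k, ∑ i ∈ Finset.range w.length, if w[i]? = some false then
        stackCount (List.replicate (d + 1) true) (w.take (i + 1)) *
          stackCount (List.replicate (d + 1) false) (w.drop (i + 1)) else 0 := by
        refine Finset.sum_le_sum fun d _ => ?_
        have h := stackCount_append_le (List.replicate d true) (List.replicate (d + 1) false) w
        rw [← List.replicate_succ'] at h
        rwa [List.replicate_succ' (n := d) (a := true), List.append_assoc, List.singleton_append,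
          ← List.replicate_succ']
    _ = ∑ i ∈ Finset.range w.length, ∑ d ∈ Finset.range k, if w[i]? = some false then
        stackCount (List.replicate (d + 1) true) (w.take (i + 1)) *
          stackCount (List.replicate (d + 1) false) (w.drop (i + 1)) else 0 := Finset.sum_comm
    _ ≤ ∑ i ∈ Finset.range w.length, if w[i]? = some false then stackCount [] w else 0 := by
        refine Finset.sum_le_sum fun i _ => ?_
        split_ifs
        · refine le_trans (Finset.sum_le_sum fun d _ => Nat.mul_le_mul_right _
            (stackCount_replicate_le true (d + 1) _)) ?_
          have h := sum_stackCount_mul_le ((Finset.range k).map (addRightEmbedding 1)) []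
            (w.take (i + 1)) (w.drop (i + 1))
          rw [List.take_append_drop, Finset.sum_map] at h
          exact h
        · simp
    _ = _ := sum_range_ite_getElem? w false _

theorem stackCount_valley_le (k : ℕ) (u v : List Bool) :
    stackCount [] (u ++ List.replicate k false ++ List.replicate k true ++ v) ≤
      ((u ++ v).count false + 1) * stackCount [] (u ++ v) := by
  have h := stackCount_valley_append_le k (v ++ u)
  rw [← List.append_assoc, stackCount_nil_append_comm, stackCount_nil_append_comm v u] at h
  simpa [List.count_append, add_comm] using h

theorem stackCount_runs_le (r : ℕ) : ∀ L : List (ℕ × ℕ), L.length = r + 1 →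
    (L.map Prod.fst).sum = (L.map Prod.snd).sum →
    stackCount [] (L.flatMap fun p => List.replicate p.1 true ++ List.replicate p.2 false) ≤
      ((L.map Prod.snd).sum + 1) ^ r := by
  induction r with
  | zero =>
    intro L hL hsum
    obtain ⟨⟨n, m⟩, rfl⟩ := List.length_eq_one_iff.1 hL
    simp only [List.map_cons, List.map_nil, List.sum_cons, List.sum_nil, add_zero] at hsum
    subst hsum
    have h := stackCount_valley_append_le n []
    rw [List.append_nil, stackCount_nil_append_comm] at h
    simpa [stackCount] using h
  | succ r ih =>
    intro L hL hsum
    obtain ⟨⟨n, m⟩, L, rfl⟩ := List.exists_cons_of_length_eq_add_one hL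
    obtain ⟨⟨n', m'⟩, L, rfl⟩ := List.exists_cons_of_length_eq_add_one (Nat.succ.inj hL)
    simp only [List.length_cons, List.map_cons, List.sum_cons] at hL hsum ⊢
    have hcount : ∀ L : List (ℕ × ℕ), (L.flatMap fun p =>
        List.replicate p.1 true ++ List.replicate p.2 false).count false =
          (L.map Prod.snd).sum := by
      intro L
      induction L with
      | nil => simp
      | cons p L ih => simp [ih, List.count_replicate]
    suffices h : ∃ u v : List Bool, ∃ k p q, (((n, m) :: (n', m') :: L).flatMap fun p =>
        List.replicate p.1 true ++ List.replicate p.2 false) =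
          u ++ List.replicate k false ++ List.replicate k true ++ v ∧
        u ++ v = (((p, q) :: L).flatMap fun p =>
          List.replicate p.1 true ++ List.replicate p.2 false) ∧
        p + k = n + n' ∧ q + k = m + m' by
      obtain ⟨u, v, k, p, q, h1, h2, h3, h4⟩ := h
      rw [h1]
      refine (stackCount_valley_le k u v).trans ?_
      rw [h2, hcount, pow_succ']
      have := ih ((p, q) :: L) (by simp; omega) (by simp; omega)
      simp only [List.map_cons, List.sum_cons] at this ⊢
      refine Nat.mul_le_mul (by omega) (this.trans (Nat.pow_le_pow_left (by omega) _))
    rcases le_total m n' with h | h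
    · obtain ⟨c, rfl⟩ := Nat.exists_eq_add_of_le h
      refine ⟨List.replicate n true, List.replicate c true ++ List.replicate m' false ++
        L.flatMap fun p => List.replicate p.1 true ++ List.replicate p.2 false, m, n + c, m',
        ?_, ?_, by omega, by omega⟩ <;>
      simp [List.replicate_add, -List.replicate_append_replicate]
    · obtain ⟨c, rfl⟩ := Nat.exists_eq_add_of_le' h
      refine ⟨List.replicate n true ++ List.replicate c false, List.replicate m' false ++
        L.flatMap fun p => List.replicate p.1 true ++ List.replicate p.2 false, n', n, c + m',
        ?_, ?_, by omega, by omega⟩ <;>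
      simp [List.replicate_add, -List.replicate_append_replicate]

theorem phi_runsF_le {r : ℕ} (n m : Fin (r + 1) → ℕ) {N : ℕ} (hN : ∑ i, n i = N)
    (hM : ∑ i, m i = N) : phi (runsF n m) ≤ (1 + N) ^ r := by
  have h := stackCount_runs_le r ((List.finRange (r + 1)).map fun i => (n i, m i)) (by simp)
  rw [List.map_map, List.map_map, List.flatMap_map] at h
  have hsum : ∀ f : Fin (r + 1) → ℕ, ((List.finRange (r + 1)).map f).sum = ∑ i, f i := fun f => by
    rw [← List.ofFn_eq_map, List.sum_ofFn]
  have h := h ((hsum n).trans (hN.trans (hM.symm.trans (hsum m).symm)))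
  rw [show ((List.finRange (r + 1)).map (Prod.snd ∘ fun i => (n i, m i))).sum = N from
    (hsum m).trans hM, add_comm N 1] at h
  exact (phi_le_stackCount _).trans h

theorem factorial_succ_le_pow (r : ℕ) : (r + 1).factorial ≤ (r + 1) ^ r := by
  induction r with
  | zero => simp
  | succ r ih =>
    rw [Nat.factorial_succ, pow_succ']
    exact Nat.mul_le_mul_left _ (ih.trans (Nat.pow_le_pow_left (by omega) r))

/-- For a balanced word of length `2N` with `r` runs,
`φ(S) ≤ (r^{r-1}/r!)·(1+N)^{r-1}` over ℝ. -/
theorem stmt9 (r : ℕ) (hr : 1 ≤ r) (n m : Fin r → ℕ)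
    (hn : ∀ i, 1 ≤ n i) (hm : ∀ i, 1 ≤ m i)
    (N : ℕ) (hN : ∑ i, n i = N) (hM : ∑ i, m i = N) :
    (phi (runsF n m) : ℝ) ≤ (r : ℝ) ^ (r - 1) / (Nat.factorial r : ℝ) * (1 + (N : ℝ)) ^ (r - 1) := by
  obtain ⟨r, rfl⟩ := Nat.exists_eq_add_of_le' hr
  rw [Nat.add_sub_cancel]
  have h1 : (phi (runsF n m) : ℝ) ≤ (1 + (N : ℝ)) ^ r := mod_cast phi_runsF_le n m hN hM
  have h2 : (1 : ℝ) ≤ ((r + 1 : ℕ) : ℝ) ^ r / ((r + 1).factorial : ℝ) := by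
    rw [one_le_div (by positivity)]
    exact_mod_cast factorial_succ_le_pow r
  exact h1.trans (le_mul_of_one_le_left (by positivity) h2)
end

section
/- Let r ≥ 1 and let n_1,…,n_r be positive integers with n_1 ≤ n_i for all i. Then φ*(n_1, n_2, …, n_r) = Σ_{i=1}^r φ*(n_1 − 1, n_2, …, n_i) · φ*(n_{i+1}, …, n_r), where for i = r the second factor is φ*() = 1, and where an argument equal to 0 corresponds to an empty run and may be deleted (so φ*(0, n_2, …, n_i) = φ*(n_2, …, n_i) and φ*(0) = 1). -/
/-- `g` is the partner function of a non-crossing pairing of the interval `[a, b)` that matches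
positions with different letters of `f`; it fixes every position outside the interval. -/
structure IsNCInvolution_s11 (f : ℕ → Bool) (a b : ℕ) (g : ℕ → ℕ) : Prop where
  eq_self : ∀ i, (i < a ∨ b ≤ i) → g i = i
  le_apply : ∀ i, a ≤ i → i < b → a ≤ g i
  apply_lt : ∀ i, a ≤ i → i < b → g i < b
  apply_apply : ∀ i, a ≤ i → i < b → g (g i) = i
  letter_ne : ∀ i, a ≤ i → i < b → f (g i) ≠ f i
  nested : ∀ i j, a ≤ i → i < j → j < g i → g j < g i

/-- The number of non-crossing pairings of the interval `[a, b)` for the letters `f`. -/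
noncomputable def ncCount (f : ℕ → Bool) (a b : ℕ) : ℕ :=
  Set.ncard {g : ℕ → ℕ | IsNCInvolution_s11 f a b g}

/-- Glue partner functions of `(a, j)` and `(j, b)` along the block `{a, j}`. -/
def glueInvolution (a j : ℕ) (p : (ℕ → ℕ) × (ℕ → ℕ)) (i : ℕ) : ℕ :=
  if i = a then j else if i = j then a else if i < j then p.1 i else p.2 i

theorem isNCInvolution_self_iff {f : ℕ → Bool} {a : ℕ} {g : ℕ → ℕ} :
    IsNCInvolution_s11 f a a g ↔ g = id := by
  constructor
  · intro h
    funext i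
    exact h.eq_self i (by omega)
  · rintro rfl
    constructor <;> intros <;> simp only [id_eq] at * <;> omega

theorem ncCount_self (f : ℕ → Bool) (a : ℕ) : ncCount f a a = 1 := by
  simp [ncCount, isNCInvolution_self_iff]

theorem IsNCInvolution_s11.glue {f : ℕ → Bool} {a j b : ℕ} {p : (ℕ → ℕ) × (ℕ → ℕ)}
    (haj : a < j) (hjb : j < b) (hf : f j ≠ f a)
    (h₁ : IsNCInvolution_s11 f (a + 1) j p.1) (h₂ : IsNCInvolution_s11 f (j + 1) b p.2) :
    IsNCInvolution_s11 f a b (glueInvolution a j p) := by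
  obtain ⟨p, q⟩ := p
  obtain ⟨a1, a2, a3, a4, a5, a6⟩ := h₁
  obtain ⟨b1, b2, b3, b4, b5, b6⟩ := h₂
  simp only at a1 a2 a3 a4 a5 a6 b1 b2 b3 b4 b5 b6
  have ev : ∀ i, a ≤ i → i < b →
      (i = a ∧ glueInvolution a j (p, q) i = j) ∨ (i = j ∧ glueInvolution a j (p, q) i = a) ∨
      (a < i ∧ i < j ∧ glueInvolution a j (p, q) i = p i ∧ a < p i ∧ p i < j) ∨
      (j < i ∧ glueInvolution a j (p, q) i = q i ∧ j < q i ∧ q i < b) := by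
    intro i hi hib
    have := a2 i
    have := a3 i
    have := b2 i
    have := b3 i
    simp only [glueInvolution]
    split_ifs <;> omega
  have out : ∀ i, (i < a ∨ b ≤ i) → glueInvolution a j (p, q) i = i := by
    intro i hi
    have := a1 i
    have := b1 i
    simp only [glueInvolution]
    split_ifs <;> omega
  refine ⟨out, fun i h h' => ?_, fun i h h' => ?_, fun i h h' => ?_, fun i h h' => ?_,
    fun i k h h' h'' => ?_⟩
  · have := ev i h h'
    omega
  · have := ev i h h'
    omega
  · have := a4 i
    have := b4 i
    rcases ev i h h' with h1 | h1 | ⟨h1, h2, h3, h4, h5⟩ | ⟨h1, h2, h3, h4⟩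
    · rw [h1.2]
      have := ev j haj.le hjb
      omega
    · rw [h1.2]
      have := ev a le_rfl (by omega)
      omega
    · rw [h3]
      have := ev (p i) (by omega) (by omega)
      omega
    · rw [h2]
      have := ev (q i) (by omega) (by omega)
      omega
  · rcases ev i h h' with h1 | h1 | ⟨h1, h2, h3, h4, h5⟩ | ⟨h1, h2, h3, h4⟩
    · rw [h1.2, h1.1]
      exact hf
    · rw [h1.2, h1.1]
      exact hf.symm
    · rw [h3]
      exact a5 i (by omega) h2
    · rw [h2]
      exact b5 i (by omega) h'
  · have hib : i < b := by
      by_contra hc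
      have := out i (by omega)
      omega
    have hkb : k < b := by
      have := ev i h hib
      omega
    have := a6 i k
    have := b6 i k
    have := ev i h hib
    have := ev k (by omega) hkb
    omega

theorem IsNCInvolution_s11.restrict_left {f : ℕ → Bool} {a b : ℕ} {g : ℕ → ℕ}
    (h : IsNCInvolution_s11 f a b g) (hab : a < b) :
    IsNCInvolution_s11 f (a + 1) (g a) (fun i => if a < i ∧ i < g a then g i else i) := by
  obtain ⟨a1, a2, a3, a4, a5, a6⟩ := h
  have := a2 a le_rfl hab
  have := a3 a le_rfl hab
  have := a4 a le_rfl hab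
  constructor <;> intros <;> grind

theorem IsNCInvolution_s11.restrict_right {f : ℕ → Bool} {a b : ℕ} {g : ℕ → ℕ}
    (h : IsNCInvolution_s11 f a b g) (hab : a < b) :
    IsNCInvolution_s11 f (g a + 1) b (fun i => if g a < i then g i else i) := by
  obtain ⟨a1, a2, a3, a4, a5, a6⟩ := h
  have := a2 a le_rfl hab
  have := a3 a le_rfl hab
  have := a4 a le_rfl hab
  constructor <;> intros <;> grind

theorem bijOn_glueInvolution {f : ℕ → Bool} {a j b : ℕ} (haj : a < j) (hjb : j < b)
    (hf : f j ≠ f a) :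
    Set.BijOn (glueInvolution a j)
      ({g | IsNCInvolution_s11 f (a + 1) j g} ×ˢ {g | IsNCInvolution_s11 f (j + 1) b g})
      {g | IsNCInvolution_s11 f a b g ∧ g a = j} := by
  refine ⟨?_, ?_, ?_⟩
  · rintro p ⟨h₁, h₂⟩
    exact ⟨h₁.glue haj hjb hf h₂, by simp [glueInvolution]⟩
  · rintro ⟨p, q⟩ ⟨h₁, h₂⟩ ⟨p', q'⟩ ⟨h₁', h₂'⟩ h
    have key := fun i => congrFun h i
    simp only [glueInvolution] at key
    have e₁ := h₁.eq_self
    have e₂ := h₂.eq_self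
    have e₁' := h₁'.eq_self
    have e₂' := h₂'.eq_self
    simp only [Prod.mk.injEq]
    constructor <;> funext i <;> grind
  · rintro g ⟨hg, rfl⟩
    refine ⟨(fun i => if a < i ∧ i < g a then g i else i, fun i => if g a < i then g i else i),
      ⟨hg.restrict_left (haj.trans hjb), hg.restrict_right (haj.trans hjb)⟩, ?_⟩
    obtain ⟨a1, a2, a3, a4, a5, a6⟩ := hg
    funext i
    have h1 := a1 i
    have h2 := a4 a le_rfl (by omega)
    simp only [glueInvolution]
    split_ifs <;> first | omega | simp_all

theorem IsNCInvolution_s11.lt_apply_left {f : ℕ → Bool} {a b : ℕ} {g : ℕ → ℕ}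
    (h : IsNCInvolution_s11 f a b g) (hab : a < b) : a < g a := by
  have h1 := h.le_apply a le_rfl hab
  have h2 := h.letter_ne a le_rfl hab
  grind

theorem finite_setOf_isNCInvolution (f : ℕ → Bool) (a b : ℕ) :
    {g | IsNCInvolution_s11 f a b g}.Finite := by
  induction hn : b - a using Nat.strong_induction_on generalizing a b with
  | _ n ih =>
    subst hn
    rcases lt_or_ge a b with hab | hab
    · refine Set.Finite.subset (s := ⋃ j ∈ Finset.Ioo a b,
        glueInvolution a j '' ({g | IsNCInvolution_s11 f (a + 1) j g} ×ˢ
          {g | IsNCInvolution_s11 f (j + 1) b g})) ?_ ?_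
      · refine Set.Finite.biUnion (Finset.finite_toSet _) fun j hj => ?_
        have hj' := Finset.mem_Ioo.1 hj
        exact ((ih _ (by omega) _ _ rfl).prod (ih _ (by omega) _ _ rfl)).image _
      · intro g hg
        have h1 := hg.lt_apply_left hab
        have h2 := hg.apply_lt a le_rfl hab
        have h3 := (bijOn_glueInvolution h1 h2 (hg.letter_ne a le_rfl hab)).surjOn ⟨hg, rfl⟩
        simp only [Set.mem_iUnion]
        exact ⟨g a, Finset.mem_Ioo.2 ⟨h1, h2⟩, h3⟩
    · refine (Set.finite_singleton id).subset fun g hg => ?_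
      funext i
      exact hg.eq_self i (by omega)

/-- Decomposition along the block containing the first position. -/
theorem ncCount_eq_sum_first (f : ℕ → Bool) {a b : ℕ} (hab : a < b) :
    ncCount f a b = ∑ j ∈ Finset.Ioo a b,
      if f j ≠ f a then ncCount f (a + 1) j * ncCount f (j + 1) b else 0 := by
  classical
  rw [ncCount, Set.ncard_eq_toFinset_card _ (finite_setOf_isNCInvolution f a b),
    Finset.card_eq_sum_card_fiberwise (f := fun g => g a) (t := Finset.Ioo a b)]
  · refine Finset.sum_congr rfl fun j hj => ?_
    obtain ⟨haj, hjb⟩ := Finset.mem_Ioo.1 hj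
    rw [← Set.ncard_coe_finset]
    have hset : ((finite_setOf_isNCInvolution f a b).toFinset.filter (fun g => g a = j) :
        Set (ℕ → ℕ)) = {g | IsNCInvolution_s11 f a b g ∧ g a = j} := by
      ext g
      simp
    rw [hset]
    split_ifs with hf
    · have h := bijOn_glueInvolution haj hjb hf
      rw [← h.image_eq, h.injOn.ncard_image, Set.ncard_prod, ncCount, ncCount]
    · rw [Set.ncard_eq_zero (((finite_setOf_isNCInvolution f a b)).subset fun g hg => hg.1)]
      ext g
      simp only [Set.mem_ofPred_eq, Set.mem_empty_iff_false, iff_false]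
      rintro ⟨hg, rfl⟩
      exact hf (hg.letter_ne a le_rfl hab)
  · intro g hg
    have hg : IsNCInvolution_s11 f a b g := by simpa using hg
    simpa using ⟨hg.lt_apply_left hab, hg.apply_lt a le_rfl hab⟩

/-- Decomposition along the block containing the last position. -/
theorem ncCount_eq_sum_last (f : ℕ → Bool) {a b : ℕ} (hab : a ≤ b) :
    ncCount f a (b + 1) = ∑ j ∈ Finset.Ico a b,
      if f j ≠ f b then ncCount f a j * ncCount f (j + 1) b else 0 := by
  induction hn : b - a using Nat.strong_induction_on generalizing a b with
  | _ n ih =>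
    subst hn
    rw [ncCount_eq_sum_first f (by omega)]
    rcases hab.eq_or_lt with rfl | hab
    · simp
    have e1 : Finset.Ioo a (b + 1) = insert b (Finset.Ioo a b) := by
      ext; simp only [Finset.mem_Ioo, Finset.mem_insert]; omega
    have e2 : Finset.Ico a b = insert a (Finset.Ioo a b) := by
      ext; simp only [Finset.mem_Ioo, Finset.mem_Ico, Finset.mem_insert]; omega
    rw [e1, e2, Finset.sum_insert (by simp), Finset.sum_insert (by simp), ncCount_self,
      ncCount_self, one_mul, mul_one]
    congr 1
    · simp [eq_comm]
    have l : ∀ j ∈ Finset.Ioo a b,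
        (if f j ≠ f a then ncCount f (a + 1) j * ncCount f (j + 1) (b + 1) else 0) =
        ∑ k ∈ Finset.Ico (j + 1) b, if f j ≠ f a ∧ f k ≠ f b then
          ncCount f (a + 1) j * ncCount f (j + 1) k * ncCount f (k + 1) b else 0 := by
      intro j hj
      have hj' := Finset.mem_Ioo.1 hj
      rw [ih (b - (j + 1)) (by omega) (by omega) rfl, Finset.mul_sum]
      split_ifs with h
      · refine Finset.sum_congr rfl fun k _ => ?_
        by_cases hk : f k = f b <;> simp [h, hk, mul_assoc]
      · simp [h]
    have r : ∀ k ∈ Finset.Ioo a b,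
        (if f k ≠ f b then ncCount f a k * ncCount f (k + 1) b else 0) =
        ∑ j ∈ Finset.Ioo a k, if f j ≠ f a ∧ f k ≠ f b then
          ncCount f (a + 1) j * ncCount f (j + 1) k * ncCount f (k + 1) b else 0 := by
      intro k hk
      have hk' := Finset.mem_Ioo.1 hk
      rw [ncCount_eq_sum_first f hk'.1, Finset.sum_mul]
      split_ifs with h
      · refine Finset.sum_congr rfl fun j _ => ?_
        simp [h]
      · simp [h]
    rw [Finset.sum_congr rfl l, Finset.sum_congr rfl r]
    refine Finset.sum_comm' fun j k => ?_
    simp only [Finset.mem_Ioo, Finset.mem_Ico]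
    omega

theorem ncCount_congr {f g : ℕ → Bool} {a b l : ℕ} (h : ∀ i < l, f (a + i) = g (b + i)) :
    ncCount f a (a + l) = ncCount g b (b + l) := by
  induction l using Nat.strong_induction_on generalizing a b with
  | _ l ih =>
    rcases l with _ | l
    · simp [ncCount_self]
    have e : ∀ c, Finset.Ioo c (c + (l + 1)) = Finset.Ico (c + 1) (c + (l + 1)) := by
      intro c
      ext
      simp only [Finset.mem_Ioo, Finset.mem_Ico]
      omega
    rw [ncCount_eq_sum_first f (by omega), ncCount_eq_sum_first g (by omega), e, e,
      Finset.sum_Ico_eq_sum_range, Finset.sum_Ico_eq_sum_range,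
      show a + (l + 1) - (a + 1) = l by omega, show b + (l + 1) - (b + 1) = l by omega]
    refine Finset.sum_congr rfl fun i hi => ?_
    have hi := Finset.mem_range.1 hi
    have h0 : f a = g b := h 0 (by omega)
    have h1 : f (a + 1 + i) = g (b + 1 + i) := by
      have := h (1 + i) (by omega)
      rwa [← add_assoc, ← add_assoc] at this
    have h2 : ncCount f (a + 1) (a + 1 + i) = ncCount g (b + 1) (b + 1 + i) := by
      refine ih i (by omega) fun k hk => ?_
      have := h (1 + k) (by omega)
      rwa [← add_assoc, ← add_assoc] at this
    have h3 : ncCount f (a + 1 + i + 1) (a + (l + 1)) =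
        ncCount g (b + 1 + i + 1) (b + (l + 1)) := by
      have := ih (l - 1 - i) (by omega) (a := a + 1 + i + 1) (b := b + 1 + i + 1) fun k hk => by
        have := h (1 + i + 1 + k) (by omega)
        rwa [← add_assoc, ← add_assoc, ← add_assoc, ← add_assoc, ← add_assoc, ← add_assoc] at this
      rwa [show a + 1 + i + 1 + (l - 1 - i) = a + (l + 1) by omega,
        show b + 1 + i + 1 + (l - 1 - i) = b + (l + 1) by omega] at this
    rw [h0, h1, h2, h3]

/-- The blocks `{i, g i}` of a partner function `g`. -/
def blocksOf (N : ℕ) (g : ℕ → ℕ) : Set (Finset (Fin N)) :=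
  {B | ∃ i j : Fin N, g i = j ∧ B = {i, j}}

theorem IsNCInvolution_s11.isNCPairingOn {w : List Bool} {g : ℕ → ℕ}
    (h : IsNCInvolution_s11 (fun i => w.getD i false) 0 w.length g)
    {π : Finset (Finset (Fin w.length))} (hπ : ∀ B, B ∈ π ↔ B ∈ blocksOf w.length g) :
    IsNCPairingOn w π := by
  obtain ⟨a1, a2, a3, a4, a5, a6⟩ := h
  have hget : ∀ i : Fin w.length, w.getD i false = w.get i := fun i => by simp
  have mem : ∀ B ∈ π, ∀ i ∈ B, ∀ k ∈ B, i = k ∨ g i = k := by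
    intro B hB i hi k hk
    obtain ⟨x, y, hxy, rfl⟩ := (hπ B).1 hB
    have := a4 x (Nat.zero_le _) x.2
    simp only [Finset.mem_insert, Finset.mem_singleton] at hi hk
    rcases hi with rfl | rfl <;> rcases hk with rfl | rfl <;> simp_all
  have ne : ∀ i : Fin w.length, g i ≠ i := by
    intro i hi
    exact a5 i (Nat.zero_le _) i.2 (by rw [hi])
  refine ⟨⟨?_, ?_⟩, ?_, ?_⟩
  · intro B hB
    obtain ⟨x, y, hxy, rfl⟩ := (hπ B).1 hB
    refine Finset.card_pair fun e => ne x ?_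
    rw [hxy, e]
  · intro i
    refine ⟨{i, ⟨g i, a3 i (Nat.zero_le _) i.2⟩},
      ⟨(hπ _).2 ⟨_, _, rfl, rfl⟩, Finset.mem_insert_self _ _⟩, ?_⟩
    rintro B ⟨hB, hi⟩
    obtain ⟨x, y, hxy, rfl⟩ := (hπ B).1 hB
    have h4 := a4 x (Nat.zero_le _) x.2
    simp only [Finset.mem_insert, Finset.mem_singleton] at hi
    rcases hi with rfl | rfl
    · congr
      exact Fin.ext hxy.symm
    · rw [Finset.pair_comm]
      congr
      exact Fin.ext (hxy ▸ h4).symm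
  · rintro ⟨B, hB, C, hC, i₁, i₂, j₁, j₂, hi₁, hi₂, hj₁, hj₂, h1, h2, h3⟩
    have hi : g i₁ = i₂ := (mem B hB _ hi₁ _ hi₂).resolve_left (by rintro rfl; omega)
    have hj : g j₁ = j₂ := (mem C hC _ hj₁ _ hj₂).resolve_left (by rintro rfl; omega)
    have := a6 i₁ j₁ (Nat.zero_le _) h1 (by omega)
    omega
  · intro B hB i hi k hk hik
    have hg := (mem B hB i hi k hk).resolve_left hik
    have := a5 i (Nat.zero_le _) i.2
    rw [hg, hget, hget] at this
    exact this.symm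

theorem IsNCPairingOn.exists_involution_s11 {w : List Bool} {π : Finset (Finset (Fin w.length))}
    (h : IsNCPairingOn w π) :
    ∃ g, IsNCInvolution_s11 (fun i => w.getD i false) 0 w.length g ∧
      ∀ B, B ∈ π ↔ B ∈ blocksOf w.length g := by
  obtain ⟨⟨hcard, huniq⟩, hcr, hlet⟩ := h
  have hget : ∀ i : Fin w.length, w.getD i false = w.get i := fun i => by simp
  have hex : ∀ i : Fin w.length, ∃ j, j ≠ i ∧ {i, j} ∈ π := by
    intro i
    obtain ⟨B, ⟨hB, hi⟩, -⟩ := huniq i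
    obtain ⟨x, y, hxy, rfl⟩ := Finset.card_eq_two.1 (hcard B hB)
    simp only [Finset.mem_insert, Finset.mem_singleton] at hi
    rcases hi with rfl | rfl
    · exact ⟨y, hxy.symm, hB⟩
    · exact ⟨x, hxy, Finset.pair_comm x i ▸ hB⟩
  choose p hp hpm using hex
  have huq : ∀ i j, j ≠ i → {i, j} ∈ π → p i = j := by
    intro i j hj hm
    have hE := (huniq i).unique ⟨hm, Finset.mem_insert_self _ _⟩
      ⟨hpm i, Finset.mem_insert_self _ _⟩
    have : p i ∈ ({i, j} : Finset _) := hE ▸ by simp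
    simp only [Finset.mem_insert, Finset.mem_singleton] at this
    exact this.resolve_left (hp i)
  have hpp : ∀ i, p (p i) = i := fun i =>
    huq _ _ (hp i).symm (Finset.pair_comm i (p i) ▸ hpm i)
  let g : ℕ → ℕ := fun i => if hi : i < w.length then (p ⟨i, hi⟩ : ℕ) else i
  have hg : ∀ i : Fin w.length, g i = p i := fun i => by simp [g]
  have hcross : ∀ i j : Fin w.length, i < j → j < p i → p j < p i := by
    intro i j hij hj
    by_contra hc
    rcases eq_or_lt_of_le (not_lt.1 hc) with he | hl
    · have := congrArg p he
      rw [hpp, hpp] at this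
      omega
    · exact hcr ⟨_, hpm i, _, hpm j, i, p i, j, p j, by simp, by simp, by simp, by simp,
        hij, hj, hl⟩
  refine ⟨g, ⟨?_, ?_, ?_, ?_, ?_, ?_⟩, ?_⟩
  · intro i hi
    simp only [g]
    rw [dif_neg (by omega)]
  · intros
    exact Nat.zero_le _
  · intro i _ hi
    rw [hg ⟨i, hi⟩]
    exact (p _).2
  · intro i _ hi
    rw [hg ⟨i, hi⟩, hg, hpp]
  · intro i _ hi
    have := hlet _ (hpm ⟨i, hi⟩) ⟨i, hi⟩ (by simp) (p ⟨i, hi⟩) (by simp) (hp _).symm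
    rw [hg ⟨i, hi⟩, hget, hget ⟨i, hi⟩]
    exact this.symm
  · intro i j _ hij hj
    have hi : i < w.length := by
      by_contra hc
      have : g i = i := by simp [g, hc]
      omega
    rw [hg ⟨i, hi⟩] at hj ⊢
    have hjw : j < w.length := hj.trans (p _).2
    rw [hg ⟨j, hjw⟩]
    exact hcross ⟨i, hi⟩ ⟨j, hjw⟩ hij hj
  · intro B
    constructor
    · intro hB
      obtain ⟨x, y, hxy, rfl⟩ := Finset.card_eq_two.1 (hcard B hB)
      exact ⟨x, y, by rw [hg, huq x y hxy.symm hB], rfl⟩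
    · rintro ⟨x, y, hxy, rfl⟩
      rw [hg] at hxy
      rw [← Fin.ext hxy]
      exact hpm x

theorem phi_eq_ncCount (w : List Bool) :
    phi w = ncCount (fun i => w.getD i false) 0 w.length := by
  classical
  have key : Set.BijOn (fun g => (blocksOf w.length g).toFinset)
      {g | IsNCInvolution_s11 (fun i => w.getD i false) 0 w.length g}
      {π | IsNCPairingOn w π} := by
    refine ⟨?_, ?_, ?_⟩
    · intro g hg
      exact hg.isNCPairingOn fun B => by simp
    · intro g hg g' hg' h
      have h : blocksOf w.length g = blocksOf w.length g' := by simpa using h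
      funext i
      by_cases hi : i < w.length
      · have hm : ({⟨i, hi⟩, ⟨g i, hg.apply_lt i (Nat.zero_le _) hi⟩} : Finset (Fin w.length)) ∈
            blocksOf w.length g := ⟨_, _, rfl, rfl⟩
        rw [h] at hm
        obtain ⟨x, y, hxy, hB⟩ := hm
        have e1 : (⟨i, hi⟩ : Fin w.length) ∈ ({x, y} : Finset (Fin w.length)) := hB ▸ by simp
        have e2 : y ∈ ({⟨i, hi⟩, ⟨g i, hg.apply_lt i (Nat.zero_le _) hi⟩} :
          Finset (Fin w.length)) := hB ▸ by simp
        have e3 : x ∈ ({⟨i, hi⟩, ⟨g i, hg.apply_lt i (Nat.zero_le _) hi⟩} :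
          Finset (Fin w.length)) := hB ▸ by simp
        have h4 := hg'.apply_apply x (Nat.zero_le _) x.2
        have hne : (x : ℕ) ≠ y := by
          intro e
          refine hg'.letter_ne x (Nat.zero_le _) x.2 ?_
          rw [hxy, e]
        simp only [Finset.mem_insert, Finset.mem_singleton, Fin.ext_iff] at e1 e2 e3
        rw [hxy] at h4
        rcases e1 with e1 | e1
        · rw [e1, hxy]
          rw [e1] at e2
          omega
        · rw [e1, h4]
          rw [e1] at e3
          omega
      · rw [hg.eq_self i (by omega), hg'.eq_self i (by omega)]
    · intro π hπ
      obtain ⟨g, hg, hB⟩ := hπ.exists_involution_s11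
      refine ⟨g, hg, ?_⟩
      ext B
      simp [hB]
  rw [phi, ncCount, ← key.image_eq, key.injOn.ncard_image]

theorem ncCount_eq_phi {f : ℕ → Bool} {a b : ℕ} (w : List Bool) (hb : b = a + w.length)
    (hf : ∀ i < w.length, f (a + i) = w.getD i false) : ncCount f a b = phi w := by
  subst hb
  rw [phi_eq_ncCount]
  simpa using ncCount_congr (f := f) (g := fun i => w.getD i false) (a := a) (b := 0)
    (l := w.length) (by simpa using hf)

/-- The sum of `phi (u ++ x) * phi y` over the splittings `w = x ++ b :: y` with `b ≠ a`. -/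
noncomputable def splitSum (a : Bool) : List Bool → List Bool → ℕ
  | _, [] => 0
  | u, b :: y => (if b ≠ a then phi u * phi y else 0) + splitSum a (u ++ [b]) y

theorem splitSum_eq_sum (a : Bool) (u w : List Bool) :
    splitSum a u w = ∑ i ∈ Finset.range w.length,
      if w.getD i false ≠ a then phi (u ++ w.take i) * phi (w.drop (i + 1)) else 0 := by
  induction w generalizing u with
  | nil => simp [splitSum]
  | cons b y ih =>
    rw [splitSum, ih, List.length_cons, Finset.sum_range_succ', add_comm]
    simp

theorem phi_cons (a : Bool) (w : List Bool) : phi (a :: w) = splitSum a [] w := by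
  rw [phi_eq_ncCount, splitSum_eq_sum, ncCount_eq_sum_first _ (by simp)]
  have e : Finset.Ioo 0 (a :: w).length = Finset.Ico 1 (w.length + 1) := by
    ext
    simp only [Finset.mem_Ioo, Finset.mem_Ico, List.length_cons]
    omega
  rw [e, Finset.sum_Ico_eq_sum_range]
  refine Finset.sum_congr rfl fun i hi => ?_
  have hi : i < w.length := Finset.mem_range.1 hi
  rw [ncCount_eq_phi (w.take i), ncCount_eq_phi (w.drop (i + 1))]
  · simp [Nat.add_comm 1 i]
  · simp
    omega
  · intro j hj
    simp [show 1 + i + 1 + j = (i + 1 + j) + 1 by omega]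
  · simp
    omega
  · intro j hj
    simp only [List.length_take] at hj
    simp only [show 0 + 1 + j = j + 1 by omega, List.getD_cons_succ]
    grind

theorem phi_append_singleton (a : Bool) (w : List Bool) :
    phi (w ++ [a]) = splitSum a [] w := by
  rw [phi_eq_ncCount, splitSum_eq_sum, List.length_append, List.length_singleton,
    ncCount_eq_sum_last _ (Nat.zero_le _), Finset.range_eq_Ico]
  refine Finset.sum_congr rfl fun i hi => ?_
  have hi : i < w.length := (Finset.mem_Ico.1 hi).2
  rw [ncCount_eq_phi (w.take i), ncCount_eq_phi (w.drop (i + 1))]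
  · grind
  · simp
    omega
  · intro j hj
    simp only [List.length_drop] at hj
    grind
  · simp
    omega
  · intro j hj
    simp only [List.length_take] at hj
    grind

theorem phi_append_comm (x y : List Bool) : phi (x ++ y) = phi (y ++ x) := by
  induction x generalizing y with
  | nil => simp
  | cons a x ih =>
    rw [List.cons_append, phi_cons, ← phi_append_singleton, List.append_assoc, ih]
    simp

theorem exists_of_splitSum_ne_zero {a : Bool} {u w : List Bool} (h : splitSum a u w ≠ 0) :
    ∃ x b y, w = x ++ b :: y ∧ b ≠ a ∧ phi (u ++ x) ≠ 0 ∧ phi y ≠ 0 := by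
  induction w generalizing u with
  | nil => simp [splitSum] at h
  | cons b w ih =>
    by_cases h0 : splitSum a (u ++ [b]) w = 0
    · rw [splitSum, h0] at h
      have : b ≠ a ∧ phi u ≠ 0 ∧ phi w ≠ 0 := by simpa using h
      exact ⟨[], b, w, rfl, this.1, by simpa using this.2.1, this.2.2⟩
    · obtain ⟨x, c, y, rfl, hc, hx, hy⟩ := ih h0
      exact ⟨b :: x, c, y, rfl, hc, by simpa using hx, hy⟩

theorem count_eq_of_phi_ne_zero {w : List Bool} (h : phi w ≠ 0) :
    w.count true = w.count false := by
  induction hn : w.length using Nat.strong_induction_on generalizing w with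
  | _ n ih =>
    subst hn
    rcases w with _ | ⟨a, w⟩
    · rfl
    rw [phi_cons] at h
    obtain ⟨x, b, y, rfl, hb, hx, hy⟩ := exists_of_splitSum_ne_zero h
    have h1 := ih x.length (by simp) (by simpa using hx) rfl
    have h2 := ih y.length (by simp; omega) hy rfl
    cases a <;> cases b <;> simp_all <;> omega

theorem phi_eq_zero_of_count_ne {w : List Bool} (h : w.count true ≠ w.count false) :
    phi w = 0 := by
  by_contra h0
  exact h (count_eq_of_phi_ne_zero h0)

theorem splitSum_replicate_true (u y : List Bool) (c : ℕ) :
    splitSum true u (List.replicate c true ++ y) = splitSum true (u ++ List.replicate c true) y := by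
  induction c generalizing u with
  | zero => simp
  | succ c ih =>
    simp only [List.replicate_succ, List.cons_append, splitSum]
    simp [ih]

theorem splitSum_replicate_false {u : List Bool} (y : List Bool) {c : ℕ}
    (h : u.count false + c ≤ u.count true ∨ u.count true < u.count false) :
    splitSum true u (List.replicate c false ++ y) =
      splitSum true (u ++ List.replicate c false) y := by
  induction c generalizing u with
  | zero => simp
  | succ c ih =>
    simp only [List.replicate_succ, List.cons_append, splitSum]
    rw [ih (by simp; omega), phi_eq_zero_of_count_ne (w := u) (by omega)]
    simp

/-- A run of zeros that starts at height `h` and crosses level zero contributes exactly one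
splitting. -/
theorem splitSum_replicate_false_of_lt {u : List Bool} (y : List Bool) {h k : ℕ}
    (hu : u.count true = u.count false + h) :
    splitSum true u (List.replicate (h + 1 + k) false ++ y) =
      phi (u ++ List.replicate h false) * phi (List.replicate k false ++ y) +
      splitSum true (u ++ List.replicate (h + 1 + k) false) y := by
  rw [List.replicate_add, List.replicate_succ', List.append_assoc, List.append_assoc,
    splitSum_replicate_false _ (by omega), List.singleton_append, splitSum,
    splitSum_replicate_false _ (by simp [List.count_replicate]; omega)]
  simp

/-- The word `0^c 1^{x₁} 0^{x₁} ⋯ 1^{x_r} 0^{x_r}` with its last `k` zeros removed. -/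
def truncWord (k : ℕ) : ℕ → List ℕ → List Bool
  | c, [] => List.replicate (c - k) false
  | c, x :: t => List.replicate c false ++ (List.replicate x true ++ truncWord k x t)

theorem truncWord_append {k c : ℕ} {t : List ℕ} (hc : k ≤ c) (ht : ∀ x ∈ t, k ≤ x) :
    truncWord k c t ++ List.replicate k false = List.replicate c false ++ symWord t := by
  induction t generalizing c with
  | nil =>
    simp only [truncWord, symWord, List.flatMap_nil, List.append_nil, ← List.replicate_add]
    congr 1
    omega
  | cons x t ih =>
    rw [truncWord, List.append_assoc, List.append_assoc, ih (ht x (by simp))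
      fun z hz => ht z (by simp [hz])]
    simp [symWord]

theorem phi_truncWord_self {k : ℕ} {t : List ℕ} (ht : ∀ x ∈ t, k ≤ x) :
    phi (truncWord k k t) = phiStar t := by
  rcases t with _ | ⟨x, t⟩
  · simp [truncWord, phiStar, symWord]
  have h := truncWord_append le_rfl ht
  rw [truncWord, List.append_assoc] at h
  rw [phiStar, ← List.append_cancel_left h, truncWord, phi_append_comm]

theorem splitSum_truncWord {k : ℕ} {u : List Bool} {c : ℕ} {t : List ℕ} (hc : k < c)
    (ht : ∀ x ∈ t, k < x) (hu : u.count true + k + 1 = u.count false + c) :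
    splitSum true u (truncWord k c t) = ∑ i ∈ Finset.range (t.length + 1),
      phi (u ++ truncWord (k + 1) c (t.take i)) * phi (truncWord k k (t.drop i)) := by
  obtain ⟨h, rfl⟩ : ∃ h, c = h + 1 + k := ⟨c - k - 1, by omega⟩
  have hu' : u.count true = u.count false + h := by omega
  induction t generalizing u h with
  | nil =>
    have := splitSum_replicate_false_of_lt [] (k := 0) hu'
    simpa [truncWord, splitSum, show h + 1 + k - (k + 1) = h by omega] using this
  | cons x t ih =>
    have hx : k < x := ht x (by simp)
    rw [List.length_cons, Finset.sum_range_succ', truncWord,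
      splitSum_replicate_false_of_lt _ hu', splitSum_replicate_true, add_comm]
    obtain ⟨d, rfl⟩ : ∃ d, x = d + 1 + k := ⟨x - k - 1, by omega⟩
    rw [ih (fun z hz => ht z (by simp [hz])) d hx (by simp [List.count_replicate]; omega)
      (by simp [List.count_replicate]; omega)]
    simp [truncWord, show h + 1 + k - (k + 1) = h by omega]

/-- `φ*(m, t)` in terms of `t` alone, valid when `m` is at most every entry of `t`. -/
noncomputable def phiStarIter : ℕ → List ℕ → ℕ
  | 0, t => phiStar t
  | m + 1, t => ∑ i ∈ Finset.range (t.length + 1),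
      phiStarIter m (t.take i) * phiStar (t.drop i)

theorem phi_replicate_append_truncWord (m k : ℕ) {t : List ℕ} (ht : ∀ x ∈ t, m + k ≤ x) :
    phi (List.replicate m true ++ truncWord k (m + k) t) = phiStarIter m t := by
  induction m generalizing k t with
  | zero =>
    simp only [List.replicate_zero, List.nil_append, Nat.zero_add, phiStarIter] at *
    exact phi_truncWord_self ht
  | succ m ih =>
    rw [List.replicate_succ, List.cons_append, phi_cons, splitSum_replicate_true,
      splitSum_truncWord (by omega) (fun x hx => by have := ht x hx; omega)
        (by simp [List.count_replicate]; omega),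
      phiStarIter]
    refine Finset.sum_congr rfl fun i _ => ?_
    rw [phi_truncWord_self fun x hx => by have := ht x (List.mem_of_mem_drop hx); omega,
      List.nil_append, show m + 1 + k = m + (k + 1) by omega,
      ih (k + 1) fun x hx => by have := ht x (List.mem_of_mem_take hx); omega]

theorem phiStar_cons {m : ℕ} {t : List ℕ} (ht : ∀ x ∈ t, m ≤ x) :
    phiStar (m :: t) = phiStarIter m t := by
  have h := truncWord_append (Nat.zero_le m) (fun x (_ : x ∈ t) => Nat.zero_le x)
  rw [List.replicate_zero, List.append_nil] at h
  rw [← phi_replicate_append_truncWord m 0 ht, Nat.add_zero, h]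
  simp [phiStar, symWord]

/-- recurrence for `φ*`. If `n₁` is minimal, then
`φ*(n₁,…,n_r) = Σ_{i=1}^r φ*(n₁-1, n₂,…,n_i) · φ*(n_{i+1},…,n_r)`.
(An argument equal to `0` produces an empty run, hence may be deleted.) -/
theorem stmt11 (r : ℕ) (hr : 1 ≤ r) (n1 : ℕ) (t : List ℕ)
    (hlen : (n1 :: t).length = r)
    (hpos : 1 ≤ n1) (hpos' : ∀ x ∈ t, 1 ≤ x) (hmin : ∀ x ∈ t, n1 ≤ x) :
    phiStar (n1 :: t) =
      ∑ i ∈ Finset.Icc 1 r,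
        phiStar ((n1 - 1) :: t.take (i - 1)) * phiStar ((n1 :: t).drop i) := by
  obtain ⟨m, rfl⟩ : ∃ m, n1 = m + 1 := ⟨n1 - 1, by omega⟩
  subst hlen
  rw [phiStar_cons hmin, phiStarIter, List.length_cons, ← Finset.Ico_add_one_right_eq_Icc,
    Finset.sum_Ico_eq_sum_range, Nat.add_sub_cancel]
  refine Finset.sum_congr rfl fun i _ => ?_
  rw [Nat.add_sub_cancel, Nat.add_sub_cancel_left, Nat.add_comm 1 i, List.drop_succ_cons,
    phiStar_cons fun x hx => (Nat.le_succ m).trans (hmin x (List.mem_of_mem_take hx))]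
end
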